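/- arXiv:1507.01364 — 3 statements merged into one kernel-verified Lean document; each statement's English description precedes it below -/
import Mathlib

section
/- Let G be a connected Δ-regular finite simple graph of order n with Δ ≥ 3 satisfying (Δ−1)·Z(G) = (Δ−2)·n + 2. Let S be a zero forcing set of G of minimum cardinality among all zero forcing sets whose complement induces a connected subgraph, and let S̄ = V(G)∖S. Then (Δ−1)·|S̄| = n − 2. -/
/-- The zero forcing closure: `v` eventually becomes colored starting from `S`,
under the rule that a colored vertex all of whose other neighbors are colored
forces its remaining neighbor to become colored. -/
inductive SimpleGraph.ZeroForces {V : Type*} (G : SimpleGraph V) (S : Set V) : V → Prop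
  | init {v : V} (hv : v ∈ S) : SimpleGraph.ZeroForces G S v
  | force {u w : V} (hu : SimpleGraph.ZeroForces G S u) (hadj : G.Adj u w)
      (hall : ∀ v, G.Adj u v → v ≠ w → SimpleGraph.ZeroForces G S v) :
      SimpleGraph.ZeroForces G S w

/-- `S` is a zero forcing set of `G` if every vertex eventually becomes colored. -/
def SimpleGraph.IsZeroForcingSet {V : Type*} (G : SimpleGraph V) (S : Set V) : Prop :=
  ∀ v, G.ZeroForces S v

/-- The zero forcing number of `G`: minimum cardinality of a zero forcing set. -/
noncomputable def SimpleGraph.zeroForcingNumber {V : Type*} (G : SimpleGraph V) : ℕ :=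
  sInf {n | ∃ S : Set V, G.IsZeroForcingSet S ∧ S.ncard = n}

namespace SimpleGraph

variable {V : Type*} {G : SimpleGraph V} {S T : Set V}

/-- If `T` forces every vertex of `S`, then `T` forces every vertex that `S` forces. -/
theorem ZeroForces.of_forall_mem (h : ∀ v ∈ S, G.ZeroForces T v) {v : V}
    (hv : G.ZeroForces S v) : G.ZeroForces T v := by
  induction hv with
  | init hv => exact h _ hv
  | force _ hadj _ ihu ihall => exact .force ihu hadj ihall

/-- A vertex `u` can be removed from a zero forcing set if some other neighbor `y` of `u` has
its closed neighborhood inside the set. -/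
theorem IsZeroForcingSet.sdiff_singleton (hS : G.IsZeroForcingSet S) {u y : V} (hy : y ∈ S)
    (hyu : G.Adj y u) (hyS : ∀ v, G.Adj y v → v ∈ S) : G.IsZeroForcingSet (S \ {u}) := by
  have hu : G.ZeroForces (S \ {u}) u :=
    .force (.init ⟨hy, hyu.ne⟩) hyu fun v hv hvu => .init ⟨hyS v hv, hvu⟩
  refine fun v => (hS v).of_forall_mem fun w hw => ?_
  by_cases hwu : w = u
  · exact hwu ▸ hu
  · exact .init ⟨hw, hwu⟩

theorem IsZeroForcingSet.zeroForcingNumber_le (hS : G.IsZeroForcingSet S) :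
    G.zeroForcingNumber ≤ S.ncard :=
  Nat.sInf_le ⟨S, hS, rfl⟩

/-- A zero forcing set of minimum cardinality among those with connected complement has a
dominating complement. -/
theorem IsZeroForcingSet.exists_adj_compl [Finite V] (hconn : G.Connected)
    (hS : G.IsZeroForcingSet S) (hSc : (G.induce Sᶜ).Connected)
    (hmin : ∀ T : Set V, G.IsZeroForcingSet T → (G.induce Tᶜ).Connected → S.ncard ≤ T.ncard)
    {y : V} (hy : y ∈ S) : ∃ x ∈ Sᶜ, G.Adj x y := by
  by_contra hnot
  obtain ⟨⟨a, ha⟩⟩ := hSc.nonempty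
  obtain ⟨p⟩ := hconn.preconnected a y
  obtain ⟨d, -, hd, hd'⟩ := p.exists_boundary_dart {v | v ∈ Sᶜ ∨ ∃ x ∈ Sᶜ, G.Adj x v}
    (Or.inl ha) (not_or.mpr ⟨fun h => h hy, hnot⟩)
  obtain ⟨⟨u, z⟩, hadj⟩ := d
  obtain ⟨hzS, hz⟩ := not_or.mp hd'
  replace hzS : z ∈ S := not_not.mp hzS
  obtain huS | ⟨x, hx, hxu⟩ := hd
  · exact hz ⟨u, huS, hadj⟩
  have huS : u ∈ S := by
    by_contra h
    exact hz ⟨u, h, hadj⟩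
  have hforce := hS.sdiff_singleton hzS hadj.symm fun v hv => by
    by_contra h
    exact hz ⟨v, h, hv.symm⟩
  have hcompl : (S \ {u})ᶜ = Sᶜ ∪ {x, u} := by
    ext v
    have : v = x → v ∉ S := fun h => h ▸ hx
    simp only [Set.mem_compl_iff, Set.mem_sdiff, Set.mem_singleton_iff, Set.mem_union,
      Set.mem_insert_iff]
    tauto
  have hconn' : (G.induce (S \ {u})ᶜ).Connected := by
    rw [hcompl]
    exact induce_union_connected hSc.preconnected
      (induce_pair_connected_of_adj hxu).preconnected ⟨x, hx, Or.inl rfl⟩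
  exact (hmin _ hforce hconn').not_gt (Set.ncard_sdiff_singleton_lt_of_mem huS)

open Finset in
/-- A dominating set `s` inducing a connected subgraph of a `Δ`-regular graph satisfies
`|V| + |s| ≤ Δ |s| + 2`. -/
theorem IsRegularOfDegree.card_add_ncard_le [Fintype V] [DecidableRel G.Adj] {Δ : ℕ}
    (hreg : G.IsRegularOfDegree Δ) {s : Set V} (hs : (G.induce s).Connected)
    (hdom : ∀ y ∈ sᶜ, ∃ x ∈ s, G.Adj x y) :
    Fintype.card V + s.ncard ≤ Δ * s.ncard + 2 := by
  classical
  have hdeg (v : s) : (G.induce s).degree v + #{w ∈ G.neighborFinset v | w ∉ s} = Δ := by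
    have h : (G.induce s).degree v = #{w ∈ G.neighborFinset v | w ∈ s} := by
      rw [← card_neighborFinset_eq_degree,
        ← Finset.card_map (Function.Embedding.subtype (· ∈ s))]
      congr 1
      ext w
      simp
    rw [h, Finset.card_filter_add_card_filter_not, card_neighborFinset_eq_degree, hreg v]
  have hsum := Finset.sum_congr rfl fun (v : s) (_ : v ∈ Finset.univ) => hdeg v
  rw [Finset.sum_add_distrib, sum_degrees_eq_twice_card_edges, Finset.sum_const, smul_eq_mul,
    Finset.card_univ, ← Nat.card_eq_fintype_card, Nat.card_coe_set_eq] at hsum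
  have hedge := hs.card_vert_le_card_edgeSet_add_one
  rw [Nat.card_coe_set_eq, Nat.card_eq_fintype_card, card_edgeSet] at hedge
  have hout : sᶜ.ncard ≤ ∑ v : s, #{w ∈ G.neighborFinset v | w ∉ s} := by
    rw [Set.ncard_eq_toFinset_card']
    refine (Finset.card_le_card fun y hy => ?_).trans Finset.card_biUnion_le
    rw [Set.mem_toFinset] at hy
    obtain ⟨x, hx, hxy⟩ := hdom y hy
    exact Finset.mem_biUnion.mpr ⟨⟨x, hx⟩, Finset.mem_univ _, by simpa [hxy] using hy⟩
  have hcard := Set.ncard_add_ncard_compl s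
  rw [Nat.card_eq_fintype_card] at hcard
  rw [mul_comm Δ]
  omega

end SimpleGraph

/-- Under the equality hypothesis, a minimum zero forcing set `S` with
connected complement satisfies `(Δ−1)·|S̄| = n − 2`. -/
theorem stmt8 {V : Type*} [Fintype V] (G : SimpleGraph V) [DecidableRel G.Adj]
    (n Δ : ℕ) (hn : Fintype.card V = n) (hΔ3 : 3 ≤ Δ)
    (hreg : G.IsRegularOfDegree Δ) (hconn : G.Connected)
    (hZ : (Δ - 1) * G.zeroForcingNumber = (Δ - 2) * n + 2)
    (S : Set V) (hzf : G.IsZeroForcingSet S)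
    (hSc : (G.induce Sᶜ).Connected)
    (hmin : ∀ T : Set V, G.IsZeroForcingSet T → (G.induce Tᶜ).Connected →
      S.ncard ≤ T.ncard) :
    (Δ - 1) * (Sᶜ : Set V).ncard = n - 2 := by
  have hdom : ∀ y ∈ Sᶜᶜ, ∃ x ∈ Sᶜ, G.Adj x y := fun y hy =>
    hzf.exists_adj_compl hconn hSc hmin (not_not.mp hy)
  have hupper := hreg.card_add_ncard_le hSc hdom
  have hlower := Nat.mul_le_mul_left (Δ - 1) hzf.zeroForcingNumber_le
  have hcard := Set.ncard_add_ncard_compl S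
  rw [Nat.card_eq_fintype_card, hn] at hcard
  rw [hn] at hupper
  obtain ⟨d, rfl⟩ := Nat.exists_eq_add_of_le hΔ3
  have h₁ : 3 + d - 1 = d + 2 := by omega
  have h₂ : 3 + d - 2 = d + 1 := by omega
  rw [h₁] at hZ hlower ⊢
  rw [h₂] at hZ
  have hle : n ≤ (d + 2) * Sᶜ.ncard + 2 := by linarith
  have hge : (d + 2) * Sᶜ.ncard + 2 ≤ n := by
    rw [hZ] at hlower
    nlinarith
  omega
end

section
/- Let G be a connected Δ-regular finite simple graph of order n with Δ ≥ 3 satisfying (Δ−1)·Z(G) = (Δ−2)·n + 2. Let S be a zero forcing set of G of minimum cardinality among all zero forcing sets whose complement induces a connected subgraph, and let S̄ = V(G)∖S, so that G[S̄] is a tree and every vertex of S has exactly one neighbor in S̄. Let F_1 and F_2 be connected components of the induced subgraph G[S] such that, for i = 1, 2, some vertex of F_i is adjacent in G to a leaf z_i of the tree G[S̄]. Then either F_1 = F_2, or the sets N(F_1) ∩ S̄ and N(F_2) ∩ S̄ are disjoint. -/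
namespace SimpleGraph

open Finset

variable {V : Type*} {G : SimpleGraph V}

theorem ZeroForces.mono {S T : Set V} (h : S ⊆ T) {v : V} (hv : G.ZeroForces S v) :
    G.ZeroForces T v := by
  induction hv with
  | init hv => exact .init (h hv)
  | force _ hadj _ ihu ihall => exact .force ihu hadj ihall

theorem zeroForcingNumber_le {A : Finset V} (h : G.IsZeroForcingSet (A : Set V)) :
    G.zeroForcingNumber ≤ #A :=
  Nat.sInf_le ⟨A, h, Set.ncard_coe_finset A⟩

/-- A proper nonempty set of vertices of a connected graph has an edge leaving it. -/
theorem Connected.exists_adj_notMem [Fintype V] (hconn : G.Connected) {C : Finset V}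
    (hne : C.Nonempty) (hC : C ≠ univ) : ∃ u ∈ C, ∃ x ∉ C, G.Adj u x := by
  obtain ⟨a, ha⟩ := hne
  obtain ⟨b, hb⟩ : ∃ b, b ∉ C := by
    by_contra! h
    exact hC (eq_univ_iff_forall.2 h)
  obtain ⟨p⟩ := hconn.preconnected a b
  obtain ⟨d, -, h₁, h₂⟩ := p.exists_boundary_dart (C : Set V) ha hb
  exact ⟨d.fst, h₁, d.snd, h₂, d.adj⟩

/-- `C` is a nonempty set without isolated vertices that is colored by a set `A` whose size is, up
to the slack `s`, extremal for graphs of maximum degree `e + 2`. -/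
def GreedilyForced (G : SimpleGraph V) (e s : ℕ) (C : Finset V) : Prop :=
  C.Nonempty ∧ (∀ v ∈ C, ∃ w ∈ C, G.Adj v w) ∧
    ∃ A : Finset V, (∀ v ∈ C, G.ZeroForces (A : Set V) v) ∧ (e + 1) * #A + s ≤ e * #C + 2

theorem greedilyForced_pair [DecidableEq V] (e : ℕ) {v w : V} (h : G.Adj v w) :
    G.GreedilyForced e 0 {v, w} := by
  refine ⟨⟨v, by simp⟩, ?_, {v, w}, fun x hx => .init (by simpa using hx), ?_⟩
  · intro x hx
    simp only [mem_insert, mem_singleton] at hx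
    rcases hx with rfl | rfl
    · exact ⟨w, by simp, h⟩
    · exact ⟨v, by simp, h.symm⟩
  · rw [card_pair h.ne]
    linarith

variable [Fintype V] [DecidableRel G.Adj]

theorem IsRegularOfDegree.neighborFinset_eq_of_subset {d : ℕ} (hreg : G.IsRegularOfDegree d)
    {u v : V} (h : G.neighborFinset u ⊆ G.neighborFinset v) :
    G.neighborFinset u = G.neighborFinset v :=
  eq_of_subset_of_card_le h (by
    rw [card_neighborFinset_eq_degree, card_neighborFinset_eq_degree, hreg.degree_eq,
      hreg.degree_eq])

variable [DecidableEq V] {e s : ℕ} {C : Finset V}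

/-- Coloring all but one of the uncolored neighbors of `u` by hand and forcing the last one. -/
theorem GreedilyForced.union_neighborFinset (hreg : G.IsRegularOfDegree (e + 2))
    (h : G.GreedilyForced e s C) {u x : V} (hu : u ∈ C) (hux : G.Adj u x) (hx : x ∉ C) :
    G.GreedilyForced e (s + (e + 1 - #(G.neighborFinset u \ C))) (C ∪ G.neighborFinset u) := by
  obtain ⟨hne, hnbr, A, hA, hcard⟩ := h
  have hxN : x ∈ G.neighborFinset u \ C := by simp [hux, hx]
  have hAC : ∀ v ∈ C, G.ZeroForces (↑(A ∪ (G.neighborFinset u \ C).erase x) : Set V) v :=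
    fun v hv => (hA v hv).mono (by simp)
  have hN : ∀ v ∈ G.neighborFinset u, v ≠ x →
      G.ZeroForces (↑(A ∪ (G.neighborFinset u \ C).erase x) : Set V) v := by
    intro v hv hvx
    by_cases hvC : v ∈ C
    · exact hAC v hvC
    · exact .init (mem_coe.2 (mem_union_right _ (mem_erase.2 ⟨hvx, mem_sdiff.2 ⟨hv, hvC⟩⟩)))
  refine ⟨hne.mono subset_union_left, ?_, A ∪ (G.neighborFinset u \ C).erase x, ?_, ?_⟩
  · intro v hv
    rcases mem_union.1 hv with hv | hv
    · obtain ⟨w, hw, hvw⟩ := hnbr v hv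
      exact ⟨w, mem_union_left _ hw, hvw⟩
    · exact ⟨u, mem_union_left _ hu, ((G.mem_neighborFinset u v).1 hv).symm⟩
  · intro v hv
    rcases mem_union.1 hv with hv | hv
    · exact hAC v hv
    · by_cases hvx : v = x
      · subst hvx
        exact .force (hAC u hu) hux fun y hy hyv => hN y (by simpa using hy) hyv
      · exact hN v hv hvx
  · have hle : #(G.neighborFinset u \ C) ≤ e + 1 := by
      obtain ⟨w, hw, huw⟩ := hnbr u hu
      have hlt : #(G.neighborFinset u \ C) < #(G.neighborFinset u) :=
        card_lt_card ⟨sdiff_subset, fun hs => (mem_sdiff.1 (hs (by simpa using huw))).2 hw⟩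
      rw [card_neighborFinset_eq_degree, hreg.degree_eq] at hlt
      omega
    have hU : #(C ∪ G.neighborFinset u) = #C + #(G.neighborFinset u \ C) := by
      rw [← union_sdiff_self_eq_union, card_union_of_disjoint disjoint_sdiff]
    have hAle := card_union_le A ((G.neighborFinset u \ C).erase x)
    rw [card_erase_of_mem hxN] at hAle
    have hpos : 0 < #(G.neighborFinset u \ C) := card_pos.2 ⟨x, hxN⟩
    rw [hU]
    generalize #(G.neighborFinset u \ C) = k at *
    obtain ⟨k, rfl⟩ : ∃ j, k = j + 1 := ⟨k - 1, by omega⟩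
    obtain ⟨m, rfl⟩ : ∃ m, e = k + m := ⟨e - k, by omega⟩
    have hm : k + m + 1 - (k + 1) = m := by omega
    rw [hm]
    rw [Nat.add_sub_cancel] at hAle
    have := Nat.mul_le_mul_left (k + m + 1) hAle
    nlinarith

/-- In an extremal graph no greedy coloring has positive slack. -/
theorem GreedilyForced.slack_eq_zero (hreg : G.IsRegularOfDegree (e + 2)) (hconn : G.Connected)
    (hZ : (e + 1) * G.zeroForcingNumber = e * Fintype.card V + 2)
    (h : G.GreedilyForced e s C) : s = 0 := by
  induction hk : #Cᶜ using Nat.strong_induction_on generalizing s C with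
  | _ k ih =>
    by_cases hC : C = univ
    · subst hC
      obtain ⟨-, -, A, hA, hcard⟩ := h
      have := Nat.mul_le_mul_left (e + 1) (zeroForcingNumber_le fun v => hA v (mem_univ v))
      rw [card_univ] at hcard
      omega
    · obtain ⟨u, hu, x, hx, hux⟩ := hconn.exists_adj_notMem h.1 hC
      have hlt : #(C ∪ G.neighborFinset u)ᶜ < k := by
        rw [← hk]
        refine card_lt_card (compl_ssubset_compl.2 ⟨subset_union_left, fun hs => hx (hs ?_)⟩)
        simp [hux]
      have := ih _ hlt (h.union_neighborFinset hreg hu hux hx) rfl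
      omega

theorem GreedilyForced.union (hreg : G.IsRegularOfDegree (e + 2)) (hconn : G.Connected)
    (hZ : (e + 1) * G.zeroForcingNumber = e * Fintype.card V + 2)
    (h : G.GreedilyForced e 0 C) {u : V} (hu : u ∈ C) :
    G.GreedilyForced e 0 (C ∪ G.neighborFinset u) := by
  by_cases hs : G.neighborFinset u ⊆ C
  · rwa [union_eq_left.2 hs]
  · obtain ⟨x, hux, hx⟩ := not_subset.1 hs
    have := h.union_neighborFinset hreg hu (by simpa using hux) hx
    rwa [this.slack_eq_zero hreg hconn hZ] at this

theorem GreedilyForced.le_card_sdiff (hreg : G.IsRegularOfDegree (e + 2)) (hconn : G.Connected)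
    (hZ : (e + 1) * G.zeroForcingNumber = e * Fintype.card V + 2)
    (h : G.GreedilyForced e 0 C) {u x : V} (hu : u ∈ C) (hux : G.Adj u x) (hx : x ∉ C) :
    e + 1 ≤ #(G.neighborFinset u \ C) := by
  have := (h.union_neighborFinset hreg hu hux hx).slack_eq_zero hreg hconn hZ
  omega

theorem GreedilyForced.mem_of_adj (hreg : G.IsRegularOfDegree (e + 2)) (hconn : G.Connected)
    (hZ : (e + 1) * G.zeroForcingNumber = e * Fintype.card V + 2)
    (h : G.GreedilyForced e 0 C) {u a b x : V} (hu : u ∈ C) (ha : a ∈ C) (hb : b ∈ C)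
    (hab : a ≠ b) (hua : G.Adj u a) (hub : G.Adj u b) (hux : G.Adj u x) : x ∈ C := by
  by_contra hx
  have h₁ := h.le_card_sdiff hreg hconn hZ hu hux hx
  have h₂ : #({a, b} ∪ G.neighborFinset u \ C) ≤ #(G.neighborFinset u) := by
    refine card_le_card (union_subset ?_ sdiff_subset)
    simp [insert_subset_iff, hua, hub]
  rw [card_union_of_disjoint, card_pair hab, card_neighborFinset_eq_degree, hreg.degree_eq] at h₂
  · omega
  · simp [ha, hb]

theorem insert_neighborFinset_eq_of_triangle (hreg : G.IsRegularOfDegree (e + 2))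
    (hconn : G.Connected) (hZ : (e + 1) * G.zeroForcingNumber = e * Fintype.card V + 2)
    {v a b : V} (hva : G.Adj v a) (hvb : G.Adj v b) (hab : G.Adj a b) :
    insert a (G.neighborFinset a) = insert v (G.neighborFinset v) := by
  have hC := (greedilyForced_pair e hva).union hreg hconn hZ (u := v) (by simp)
  refine eq_of_subset_of_card_le ?_ ?_
  · intro x hx
    rcases mem_insert.1 hx with rfl | hx
    · simp [hva]
    · have := hC.mem_of_adj hreg hconn hZ (u := a) (a := v) (b := b) (x := x) (by simp) (by simp)
        (by simp [hvb]) hvb.ne hva.symm hab (by simpa using hx)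
      simp only [mem_union, mem_insert, mem_singleton, mem_neighborFinset] at this ⊢
      rcases this with (rfl | rfl) | h
      · exact .inl rfl
      · exact .inr hva
      · exact .inr h
  · rw [card_insert_of_notMem (by simp), card_insert_of_notMem (by simp),
      card_neighborFinset_eq_degree, card_neighborFinset_eq_degree, hreg.degree_eq,
      hreg.degree_eq]

/-- An extremal graph containing a triangle is complete. -/
theorem adj_of_triangle (hreg : G.IsRegularOfDegree (e + 2))
    (hconn : G.Connected) (hZ : (e + 1) * G.zeroForcingNumber = e * Fintype.card V + 2)
    {v a b : V} (hva : G.Adj v a) (hvb : G.Adj v b) (hab : G.Adj a b) {x y : V} (hxy : x ≠ y) :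
    G.Adj x y := by
  have hav := insert_neighborFinset_eq_of_triangle hreg hconn hZ hva hvb hab
  have key : ∀ c ∈ insert v (G.neighborFinset v),
      insert c (G.neighborFinset c) = insert v (G.neighborFinset v) := by
    intro c hc
    by_cases hcv : c = v
    · rw [hcv]
    by_cases hca : c = a
    · rw [hca, hav]
    have hvc : G.Adj v c := by simpa [hcv] using hc
    have hac : G.Adj a c := by
      rw [← hav] at hc
      simpa [hca] using hc
    exact insert_neighborFinset_eq_of_triangle hreg hconn hZ hvc hva hac.symm
  have huniv : insert v (G.neighborFinset v) = univ := by
    by_contra h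
    obtain ⟨u, hu, z, hz, huz⟩ := hconn.exists_adj_notMem (insert_nonempty _ _) h
    exact hz (key u hu ▸ by simp [huz])
  have hx := key x (huniv ▸ mem_univ x)
  have hy : y ∈ insert x (G.neighborFinset x) := by
    rw [hx, huniv]
    exact mem_univ y
  simpa [hxy.symm] using hy

/-- Two vertices of a triangle-free extremal graph are adjacent or twins. -/
theorem adj_or_neighborFinset_eq_of_triangle_free (he : 1 ≤ e)
    (hreg : G.IsRegularOfDegree (e + 2))
    (hconn : G.Connected) (hZ : (e + 1) * G.zeroForcingNumber = e * Fintype.card V + 2)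
    (hfree : ∀ v a b, G.Adj v a → G.Adj v b → ¬ G.Adj a b) (y z : V) :
    G.Adj y z ∨ G.neighborFinset y = G.neighborFinset z := by
  have hexists : ∃ C, G.GreedilyForced e 0 C ∧ C ≠ univ := by
    have hcard : #(G.neighborFinset y) = e + 2 := by
      rw [card_neighborFinset_eq_degree, hreg.degree_eq]
    obtain ⟨w, hw⟩ : (G.neighborFinset y).Nonempty := card_pos.1 (by omega)
    refine ⟨{y, w}, greedilyForced_pair e (by simpa using hw), fun h => ?_⟩
    have h₁ := card_le_card (subset_univ (G.neighborFinset y))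
    have h₂ := card_le_two (a := y) (b := w)
    rw [h] at h₂
    omega
  classical
  obtain ⟨C, ⟨hC, hCne⟩, hmax⟩ :=
    (univ.filter fun C => G.GreedilyForced e 0 C ∧ C ≠ univ).exists_max_image card
      (by simpa [Finset.Nonempty] using hexists) |>.imp fun C h =>
        And.intro (mem_filter.1 h.1).2 h.2
  obtain ⟨b, hb, x, hx, hbx⟩ := hconn.exists_adj_notMem hC.1 hCne
  have hU : C ∪ G.neighborFinset b = univ := by
    by_contra hne
    have h₁ := hmax (C ∪ G.neighborFinset b)
      (mem_filter.2 ⟨mem_univ _, hC.union hreg hconn hZ hb, hne⟩)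
    have h₂ : #C < #(C ∪ G.neighborFinset b) :=
      card_lt_card ⟨subset_union_left, fun hs => hx (hs (by simp [hbx]))⟩
    omega
  have hW : ∀ w ∉ C, G.Adj b w := by
    intro w hw
    have : w ∈ C ∪ G.neighborFinset b := hU ▸ mem_univ w
    simpa [hw] using this
  have hWcard : #Cᶜ ≤ e + 1 := by
    obtain ⟨p, hp, hbp⟩ := hC.2.1 b hb
    have hlt : #Cᶜ < #(G.neighborFinset b) := by
      refine card_lt_card ⟨fun w hw => ?_, fun hs => ?_⟩
      · simpa using hW w (by simpa using hw)
      · exact (mem_compl.1 (hs (by simpa using hbp))) hp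
    rw [card_neighborFinset_eq_degree, hreg.degree_eq] at hlt
    omega
  have hjoin : ∀ c, G.Adj x c → ∀ w ∉ C, G.Adj c w := by
    intro c hxc w hw
    have hcC : c ∈ C := by
      by_contra hc
      exact hfree b x c hbx (hW c hc) hxc
    have h₁ := hC.le_card_sdiff hreg hconn hZ hcC hxc.symm hx
    have h₂ : G.neighborFinset c \ C = Cᶜ :=
      eq_of_subset_of_card_le (fun v hv => mem_compl.2 (mem_sdiff.1 hv).2) (by omega)
    have h₃ : w ∈ G.neighborFinset c \ C := by
      rw [h₂]
      exact mem_compl.2 hw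
    simpa using (mem_sdiff.1 h₃).1
  obtain ⟨x₂, hx₂, hxy⟩ : ∃ x₂ ∉ C, x₂ ≠ x := by
    have h₁ := hC.le_card_sdiff hreg hconn hZ hb hbx hx
    obtain ⟨x₂, hx₂, hne⟩ := exists_mem_ne (s := G.neighborFinset b \ C) (by omega) x
    exact ⟨x₂, (mem_sdiff.1 hx₂).2, hne⟩
  have hD := ((greedilyForced_pair e hbx).union hreg hconn hZ (u := b) (by simp)).union
    hreg hconn hZ (u := x) (by simp)
  have hP : ∀ c, G.Adj x c → G.neighborFinset c = G.neighborFinset b := by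
    intro c hxc
    refine hreg.neighborFinset_eq_of_subset fun q hq => ?_
    rw [mem_neighborFinset] at hq ⊢
    have := hD.mem_of_adj hreg hconn hZ (u := c) (a := x) (b := x₂) (x := q) (by simp [hxc])
      (by simp) (by simp [hW x₂ hx₂]) hxy.symm hxc.symm (hjoin c hxc x₂ hx₂) hq
    simp only [mem_union, mem_insert, mem_singleton, mem_neighborFinset] at this
    rcases this with ((rfl | rfl) | h) | h
    · exact absurd hq (hfree x c q hxc hbx.symm)
    · exact hbx
    · exact h
    · exact absurd hq (hfree x c q hxc h)
  have hQ : ∀ q, G.Adj b q → G.neighborFinset q = G.neighborFinset x := by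
    intro q hq
    refine (hreg.neighborFinset_eq_of_subset fun c hc => ?_).symm
    rw [mem_neighborFinset] at hc ⊢
    have : q ∈ G.neighborFinset c := by
      rw [hP c hc]
      simpa using hq
    exact ((G.mem_neighborFinset c q).1 this).symm
  have huniv : G.neighborFinset x ∪ G.neighborFinset b = univ := by
    by_contra h
    obtain ⟨u, hu, w, hw, huw⟩ := hconn.exists_adj_notMem ⟨x, by simp [hbx]⟩ h
    rw [← mem_neighborFinset] at huw
    rw [mem_union, mem_neighborFinset, mem_neighborFinset] at hu
    rcases hu with hu | hu
    · exact hw (mem_union_right _ (hP u hu ▸ huw))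
    · exact hw (mem_union_left _ (hQ u hu ▸ huw))
  have hmem : ∀ v, G.Adj x v ∨ G.Adj b v := fun v => by
    simpa using (huniv ▸ mem_univ v : v ∈ G.neighborFinset x ∪ G.neighborFinset b)
  rcases hmem y with hy | hy <;> rcases hmem z with hz | hz
  · exact .inr ((hP y hy).trans (hP z hz).symm)
  · left
    rw [← mem_neighborFinset, hP y hy]
    simpa using hz
  · left
    rw [← mem_neighborFinset, hQ y hy]
    simpa using hz
  · exact .inr ((hQ y hy).trans (hQ z hz).symm)

/-- Two vertices of an extremal regular graph are adjacent or twins. -/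
theorem adj_or_neighborFinset_eq (he : 1 ≤ e) (hreg : G.IsRegularOfDegree (e + 2))
    (hconn : G.Connected) (hZ : (e + 1) * G.zeroForcingNumber = e * Fintype.card V + 2)
    (y z : V) : G.Adj y z ∨ G.neighborFinset y = G.neighborFinset z := by
  by_cases hfree : ∀ v a b, G.Adj v a → G.Adj v b → ¬ G.Adj a b
  · exact adj_or_neighborFinset_eq_of_triangle_free he hreg hconn hZ hfree y z
  · push Not at hfree
    obtain ⟨v, a, b, hva, hvb, hab⟩ := hfree
    by_cases hyz : y = z
    · exact .inr (hyz ▸ rfl)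
    · exact .inl (adj_of_triangle hreg hconn hZ hva hvb hab hyz)

end SimpleGraph

/-- With `G[S̄]` a tree and every vertex of `S` having exactly one
neighbor in `S̄`, if `F₁, F₂` are connected components of `G[S]` each containing a
vertex adjacent in `G` to a leaf of the tree `G[S̄]`, then `F₁ = F₂` or their
attachment sets in `S̄` are disjoint. -/
theorem stmt13 {V : Type*} [Fintype V] (G : SimpleGraph V) [DecidableRel G.Adj]
    (n Δ : ℕ) (hn : Fintype.card V = n) (hΔ3 : 3 ≤ Δ)
    (hreg : G.IsRegularOfDegree Δ) (hconn : G.Connected)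
    (hZ : (Δ - 1) * G.zeroForcingNumber = (Δ - 2) * n + 2)
    (S : Set V) (hzf : G.IsZeroForcingSet S)
    (hSc : (G.induce Sᶜ).Connected)
    (hmin : ∀ T : Set V, G.IsZeroForcingSet T → (G.induce Tᶜ).Connected →
      S.ncard ≤ T.ncard)
    (htree : (G.induce Sᶜ).IsTree)
    (hone : ∀ v ∈ S, {w : V | w ∈ Sᶜ ∧ G.Adj v w}.ncard = 1)
    (F₁ F₂ : (G.induce S).ConnectedComponent)
    (z₁ z₂ : V) (hz₁ : z₁ ∈ Sᶜ) (hz₂ : z₂ ∈ Sᶜ)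
    (hleaf₁ : {w : V | w ∈ Sᶜ ∧ G.Adj z₁ w}.ncard = 1)
    (hleaf₂ : {w : V | w ∈ Sᶜ ∧ G.Adj z₂ w}.ncard = 1)
    (hF₁ : ∃ u : S, (G.induce S).connectedComponentMk u = F₁ ∧ G.Adj (u : V) z₁)
    (hF₂ : ∃ u : S, (G.induce S).connectedComponentMk u = F₂ ∧ G.Adj (u : V) z₂) :
    F₁ = F₂ ∨
      Disjoint
        {w : V | w ∈ Sᶜ ∧ ∃ u : S, (G.induce S).connectedComponentMk u = F₁ ∧ G.Adj (u : V) w}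
        {w : V | w ∈ Sᶜ ∧ ∃ u : S, (G.induce S).connectedComponentMk u = F₂ ∧ G.Adj (u : V) w} := by
  classical
  left
  obtain ⟨u₁, rfl, -⟩ := hF₁
  obtain ⟨u₂, rfl, -⟩ := hF₂
  obtain ⟨e, rfl⟩ : ∃ e, Δ = e + 2 := ⟨Δ - 2, by omega⟩
  subst hn
  rw [SimpleGraph.ConnectedComponent.eq]
  rcases SimpleGraph.adj_or_neighborFinset_eq (e := e) (by omega) hreg hconn hZ u₁ u₂ with h | h
  · exact SimpleGraph.Adj.reachable (G := G.induce S) h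
  · obtain ⟨w, hw, hwS⟩ : ∃ w, G.Adj u₁ w ∧ w ∈ S := by
      by_contra! hno
      have heq : {w : V | w ∈ Sᶜ ∧ G.Adj u₁ w} = (G.neighborFinset (u₁ : V) : Set V) := by
        ext w
        simpa using hno w
      have hcard := hone u₁ u₁.2
      rw [heq, Set.ncard_coe_finset, SimpleGraph.card_neighborFinset_eq_degree,
        hreg.degree_eq] at hcard
      omega
    have hw₂ : G.Adj u₂ w := by
      rw [← SimpleGraph.mem_neighborFinset, ← h]
      simpa using hw
    exact (SimpleGraph.Adj.reachable (G := G.induce S) (v := ⟨w, hwS⟩) hw).trans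
      (SimpleGraph.Adj.reachable (G := G.induce S) (u := ⟨w, hwS⟩) hw₂.symm)
end

section
/- Let G be a connected Δ-regular finite simple graph of order n with Δ ≥ 3 satisfying (Δ−1)·Z(G) = (Δ−2)·n + 2. Let S be a zero forcing set of G of minimum cardinality among all zero forcing sets whose complement induces a connected subgraph, and let S̄ = V(G)∖S. Then |S̄| ≤ 2. -/
namespace SimpleGraph

variable {V : Type*} {G : SimpleGraph V}

theorem ZeroForces.trans {S T : Set V} (hST : ∀ v ∈ S, G.ZeroForces T v) {v : V}
    (hv : G.ZeroForces S v) : G.ZeroForces T v := by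
  induction hv with
  | init h => exact hST _ h
  | force _ hadj _ ihu ih => exact .force ihu hadj ih

theorem IsZeroForcingSet.of_forall_zeroForces {S T : Set V} (hS : G.IsZeroForcingSet S)
    (hST : ∀ v ∈ S, G.ZeroForces T v) : G.IsZeroForcingSet T :=
  fun v => (hS v).trans hST

/-- A colored vertex `w` can be uncolored if another colored vertex `x` forces it back at once. -/
theorem IsZeroForcingSet.of_forced {S T : Set V} (hS : G.IsZeroForcingSet S) {w x : V}
    (hx : x ∈ T) (hxw : G.Adj x w) (hST : ∀ v ∈ S, v ≠ w → v ∈ T)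
    (hN : ∀ y, G.Adj x y → y ≠ w → y ∈ T) : G.IsZeroForcingSet T := by
  refine hS.of_forall_zeroForces fun v hv => ?_
  by_cases hvw : v = w
  · exact hvw ▸ .force (.init hx) hxw fun y hy hyw => .init (hN y hy hyw)
  · exact .init (hST v hv hvw)

theorem Connected.induce_insert {U : Set V} (hU : (G.induce U).Connected) {u w : V} (hu : u ∈ U)
    (h : G.Adj w u) : (G.induce (insert w U)).Connected := by
  have hunion := induce_union_connected (induce_pair_connected_of_adj h).preconnected
    hU.preconnected ⟨u, by simp, hu⟩
  rwa [show ({w, u} ∪ U : Set V) = insert w U by grind] at hunion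

theorem Connected.induce_diff_singleton {U : Set V} (hU : (G.induce U).Connected) [Finite U] (v : U)
    (hv : ∃! b, (G.induce U).Adj v b) :
    (G.induce (U \ {v.1})).Connected := by
  classical
  have := Fintype.ofFinite U
  let f : (G.induce U).induce {v}ᶜ →g G.induce (U \ {v.1}) :=
    ⟨fun x => ⟨x.1.1, x.1.2, fun h => x.2 (Subtype.ext h)⟩, fun h => h⟩
  exact (hU.induce_compl_singleton_of_degree_eq_one
    (degree_eq_one_iff_existsUnique_adj.2 hv)).map f fun x =>
    ⟨⟨⟨x.1, x.2.1⟩, fun h => x.2.2 (congrArg Subtype.val h)⟩, rfl⟩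

/-- In a tree rooted at `r`, a vertex has only one neighbor that is not further from `r`. -/
theorem IsTree.eq_of_adj_of_dist_le (hG : G.IsTree) {r c a b : V} (ha : G.Adj c a)
    (hb : G.Adj c b) (hda : G.dist r a ≤ G.dist r c) (hdb : G.dist r b ≤ G.dist r c) : a = b := by
  have key : ∀ a, G.Adj c a → G.dist r a ≤ G.dist r c → ∀ p : G.Walk r c, p.IsPath →
      a = p.penultimate := by
    intro a ha hda p hp
    obtain ⟨q, hq⟩ := hG.connected.exists_walk_length_eq_dist r a
    have hd := hG.dist_eq_dist_add_one_of_adj r ha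
    have hpath : (q.concat ha.symm).IsPath :=
      Walk.isPath_of_length_eq_dist _ (by rw [Walk.length_concat]; omega)
    have := Subtype.mk.inj <| (hG.isAcyclic.subsingleton_path r c).elim ⟨p, hp⟩ ⟨_, hpath⟩
    simp [this]
  obtain ⟨p, hp⟩ := hG.connected.exists_isPath r c
  rw [key a ha hda p hp, key b hb hdb p hp]

section Finite

variable [Fintype V]

theorem degree_induce_add_ncard_diff (U : Set V) (v : U) [Fintype ((G.induce U).neighborSet v)]
    [Fintype (G.neighborSet v)] :
    (G.induce U).degree v + (G.neighborSet v \ U).ncard = G.degree v := by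
  have h1 : (G.induce U).degree v = (G.neighborSet v ∩ U).ncard := by
    rw [← card_neighborSet_eq_degree, ← Nat.card_eq_fintype_card, ← Nat.card_coe_set_eq]
    exact Nat.card_congr ⟨fun x => ⟨x.1.1, x.2, x.1.2⟩, fun x => ⟨⟨x.1, x.2.2⟩, x.2.1⟩,
      fun _ => rfl, fun _ => rfl⟩
  rw [h1, Set.ncard_inter_add_ncard_sdiff_eq_ncard _ _ (Set.toFinite _),
    ← card_neighborSet_eq_degree, ← Nat.card_eq_fintype_card, Nat.card_coe_set_eq]

/-- If the complement of a connected dominating set `U` of a regular graph has at least the size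
forced by the degrees, then `U` induces a tree and every other vertex has exactly one neighbor
in `U`. -/
theorem IsRegularOfDegree.isTree_and_existsUnique_adj [DecidableRel G.Adj] {Δ : ℕ}
    (hreg : G.IsRegularOfDegree Δ) {U : Set V} (hU : (G.induce U).Connected)
    (hdom : ∀ s ∉ U, ∃ u ∈ U, G.Adj s u) (hcard : Δ * U.ncard + 2 ≤ Uᶜ.ncard + 2 * U.ncard) :
    (G.induce U).IsTree ∧ ∀ s ∉ U, ∃! u, u ∈ U ∧ G.Adj s u := by
  classical
  have hE := hU.card_vert_le_card_edgeSet_add_one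
  have hsum := (G.induce U).sum_degrees_eq_twice_card_edges
  rw [edgeFinset_card, ← Nat.card_eq_fintype_card] at hsum
  have hreg' : ∑ v : U, ((G.induce U).degree v + (G.neighborSet v \ U).ncard) = Δ * U.ncard := by
    simp only [degree_induce_add_ncard_diff, hreg.degree_eq, Finset.sum_const, Finset.card_univ,
      ← Nat.card_eq_fintype_card, Nat.card_coe_set_eq, smul_eq_mul, mul_comm]
  have hdc : ∑ v : U, (G.neighborSet v \ U).ncard =
      ∑ s : (Uᶜ : Set V), (G.neighborSet s ∩ U).ncard := by
    rw [Finset.sum_set_coe U (f := fun v => (G.neighborSet v \ U).ncard),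
      Finset.sum_set_coe Uᶜ (f := fun s => (G.neighborSet s ∩ U).ncard)]
    convert Finset.sum_card_bipartiteAbove_eq_sum_card_bipartiteBelow
      (s := U.toFinset) (t := Uᶜ.toFinset) G.Adj using 2 with v _ s _
    · rw [Set.ncard_eq_toFinset_card']
      congr 1
      ext s
      simp [Finset.mem_bipartiteAbove, and_comm]
    · rw [Set.ncard_eq_toFinset_card']
      congr 1
      ext v
      simp [Finset.mem_bipartiteBelow, and_comm, adj_comm]
  have hone : ∀ s : (Uᶜ : Set V), 1 ≤ (G.neighborSet s ∩ U).ncard := fun s => by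
    obtain ⟨u, hu, hsu⟩ := hdom s s.2
    exact (Set.ncard_pos (Set.toFinite _)).2 ⟨u, hsu, hu⟩
  have hle : Uᶜ.ncard ≤ ∑ s : (Uᶜ : Set V), (G.neighborSet s ∩ U).ncard := by
    have := Finset.sum_le_sum fun s (_ : s ∈ Finset.univ) => hone s
    simpa [← Nat.card_eq_fintype_card, Nat.card_coe_set_eq] using this
  rw [Finset.sum_add_distrib] at hreg'
  rw [Nat.card_coe_set_eq] at hE
  refine ⟨isTree_iff_connected_and_card.2 ⟨hU, by rw [Nat.card_coe_set_eq U]; omega⟩, ?_⟩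
  intro s hs
  have heq : ∑ _s : (Uᶜ : Set V), 1 = ∑ s : (Uᶜ : Set V), (G.neighborSet s ∩ U).ncard := by
    have : ∑ _s : (Uᶜ : Set V), 1 = Uᶜ.ncard := by
      simp [← Nat.card_eq_fintype_card, Nat.card_coe_set_eq]
    omega
  have h1 := (Finset.sum_eq_sum_iff_of_le fun s _ => hone s).1 heq ⟨s, hs⟩ (Finset.mem_univ _)
  obtain ⟨u, hu⟩ := Set.ncard_eq_one.1 h1.symm
  simp only [Set.ext_iff, Set.mem_inter_iff, mem_neighborSet, Set.mem_singleton_iff] at hu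
  exact ⟨u, ((hu u).2 rfl).symm, fun y hy => (hu y).1 hy.symm⟩

end Finite

/-- The complement `U` of a zero forcing set is a rigid tree if it induces a tree, every other
vertex has exactly one neighbor in `U`, and no vertex can be added to `U`. -/
structure IsRigidForcedTree (G : SimpleGraph V) (U : Set V) : Prop where
  isZeroForcingSet : G.IsZeroForcingSet Uᶜ
  isTree : (G.induce U).IsTree
  existsUnique_adj : ∀ s ∉ U, ∃! u, u ∈ U ∧ G.Adj s u
  not_isZeroForcingSet_insert : ∀ w ∉ U, ¬ G.IsZeroForcingSet (insert w U)ᶜ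

theorem IsRigidForcedTree.eq_of_adj {U : Set V} (hU : G.IsRigidForcedTree U) {s u v : V}
    (hs : s ∉ U) (hu : u ∈ U) (hv : v ∈ U) (hsu : G.Adj s u) (hsv : G.Adj s v) : u = v :=
  (hU.existsUnique_adj s hs).unique ⟨hu, hsu⟩ ⟨hv, hsv⟩

theorem isRigidForcedTree_of_maximal [Fintype V] [DecidableRel G.Adj] {Δ : ℕ}
    (hreg : G.IsRegularOfDegree Δ) (hconn : G.Connected) {U : Set V}
    (hzf : G.IsZeroForcingSet Uᶜ) (hU : (G.induce U).Connected)
    (hmax : ∀ T : Set V, G.IsZeroForcingSet Tᶜ → (G.induce T).Connected → T.ncard ≤ U.ncard)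
    (hcard : Δ * U.ncard + 2 ≤ Uᶜ.ncard + 2 * U.ncard) : G.IsRigidForcedTree U := by
  have hins : ∀ w ∉ U, ∀ u ∈ U, G.Adj w u → ¬ G.IsZeroForcingSet (insert w U)ᶜ := by
    intro w hw u hu hwu h
    have := hmax _ h (hU.induce_insert hu hwu)
    rw [Set.ncard_insert_of_notMem hw (Set.toFinite _)] at this
    omega
  have hdom : ∀ s ∉ U, ∃ u ∈ U, G.Adj s u := by
    intro s hs
    by_contra! hsu
    obtain ⟨⟨u, hu⟩⟩ := hU.nonempty
    obtain ⟨p⟩ := hconn.preconnected u s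
    obtain ⟨⟨⟨w, x⟩, hwx⟩, -, hw, hx⟩ :=
      p.exists_boundary_dart {v | v ∈ U ∨ ∃ u ∈ U, G.Adj v u} (.inl hu)
        (by rintro (h | ⟨u, hu, h⟩); exacts [hs h, hsu u hu h])
    simp only [Set.mem_ofPred_eq, not_or, not_exists, not_and] at hw hx hwx
    obtain hwU | ⟨u, hu, hwu⟩ := hw
    · exact hx.2 w hwU hwx.symm
    · have hwU : w ∉ U := fun h => hx.2 w h hwx.symm
      refine hins w hwU u hu hwu (hzf.of_forced (w := w) (x := x) ?_ hwx.symm ?_ ?_)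
      · simp [hx.1, hwx.ne']
      · intro v hv hvw
        simpa [hvw] using hv
      · intro y hy hyw
        simpa [hyw] using fun h => hx.2 y h hy
  obtain ⟨htree, huniq⟩ := hreg.isTree_and_existsUnique_adj hU hdom hcard
  exact ⟨hzf, htree, huniq, fun w hw =>
    let ⟨u, hu, hwu⟩ := hdom w hw
    hins w hw u hu hwu⟩

namespace IsRigidForcedTree

variable [Fintype V] {U : Set V}

/-- Uncoloring a vertex `w` attached to `u` is obstructed by a leaf `v` whose outer neighbors are
all adjacent to `w`. -/
theorem exists_leaf (hU : G.IsRigidForcedTree U) (hnt : U.Nontrivial) {u w : V}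
    (hw : w ∉ U) (hu : u ∈ U) (hwu : G.Adj w u) :
    ∃ v : U, v.1 ≠ u ∧ (∃! b, (G.induce U).Adj v b) ∧ ∀ x ∉ U, G.Adj v x → G.Adj w x := by
  have : Nontrivial U := hnt.coe_sort
  set H := G.induce U
  let r : U := ⟨u, hu⟩
  let C : V → Prop := G.ZeroForces (insert w U)ᶜ
  have hS : ∀ s ∉ U, s ≠ w → C s := fun s hs hsw => .init (by simp [hs, hsw])
  have hwC : ¬ C w := fun h => hU.not_isZeroForcingSet_insert w hw <|
    hU.isZeroForcingSet.of_forall_zeroForces fun s hs => by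
      obtain rfl | hsw := eq_or_ne s w
      exacts [h, hS s hs hsw]
  have hnw : ∀ c : U, c ≠ r → ¬ G.Adj c w := fun c hc h =>
    hc (Subtype.ext (hU.eq_of_adj hw c.2 hu h.symm hwu))
  have hR : ∃ a : U, ¬ C a := by
    by_contra! hR
    refine hwC (.force (hR r) hwu.symm fun y _ hyw => ?_)
    by_cases hy : y ∈ U
    exacts [hR ⟨y, hy⟩, hS y hy hyw]
  obtain ⟨a, haC, hamax⟩ := Set.exists_max_image {a : U | ¬ C a} (fun a => H.dist r a)
    (Set.toFinite _) hR
  have hchild : ∀ c, H.Adj a c → H.dist r c ≤ H.dist r a := by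
    intro c hac
    by_contra! hlt
    have hcC : C c := by
      by_contra hc
      exact hlt.not_ge (hamax c hc)
    refine haC (.force hcC hac.symm fun y hcy hya => ?_)
    by_cases hy : y ∈ U
    · by_contra hyC
      have h1 := hamax ⟨y, hy⟩ hyC
      exact hya (congrArg Subtype.val (hU.isTree.eq_of_adj_of_dist_le (a := ⟨y, hy⟩) (r := r)
        (c := c) (b := a) hcy hac.symm ((h1.trans_lt hlt).le) hlt.le))
    · refine hS y hy ?_
      rintro rfl
      refine hnw c ?_ hcy
      rintro rfl
      simp at hlt
  obtain ⟨b, hab⟩ := hU.isTree.connected.preconnected.exists_adj_of_nontrivial a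
  have har : a ≠ r := by
    rintro rfl
    have := hchild b hab
    rw [dist_self, dist_eq_one_iff_adj.2 hab] at this
    omega
  refine ⟨a, fun h => har (Subtype.ext h), ?_, ?_⟩
  · exact ⟨b, hab, fun c hac =>
      hU.isTree.eq_of_adj_of_dist_le hac hab (hchild c hac) (hchild b hab)⟩
  · intro x hx hax
    by_contra hwx
    have hxw : x ≠ w := by
      rintro rfl
      exact hnw a har hax
    refine haC (.force (hS x hx hxw) hax.symm fun y hxy hya => hS y ?_ ?_)
    · exact fun hy => hya (hU.eq_of_adj hx hy a.2 hxy hax.symm)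
    · rintro rfl
      exact hwx hxy.symm

theorem exists_leaf_neighborSet_eq (hU : G.IsRigidForcedTree U) (hnt : U.Nontrivial) {Δ : ℕ}
    [DecidableRel G.Adj] (hreg : G.IsRegularOfDegree Δ) {u w : V} (hw : w ∉ U) (hu : u ∈ U)
    (hwu : G.Adj w u) :
    ∃ v : U, v.1 ≠ u ∧ (∃! b, (G.induce U).Adj v b) ∧
      G.neighborSet w = insert u (G.neighborSet v \ U) := by
  classical
  obtain ⟨v, hvu, hv, hN⟩ := hU.exists_leaf hnt hw hu hwu
  refine ⟨v, hvu, hv, (Set.eq_of_subset_of_ncard_le ?_ ?_ (Set.toFinite _)).symm⟩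
  · rintro x (rfl | ⟨hvx, hx⟩)
    exacts [hwu, hN x hx hvx]
  · have h := degree_induce_add_ncard_diff (G := G) U v
    have hcard : (G.neighborSet w).ncard = Δ := by
      rw [← hreg w, ← card_neighborSet_eq_degree, ← Nat.card_eq_fintype_card, Nat.card_coe_set_eq]
    rw [Set.ncard_insert_of_notMem (fun h => h.2 hu) (Set.toFinite _), hcard]
    rw [degree_eq_one_iff_existsUnique_adj.2 hv, hreg.degree_eq] at h
    omega

/-- A tree vertex with an outer neighbor `w` is a leaf, and all its outer neighbors are adjacent to
every outer neighbor of a second leaf. -/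
theorem exists_leaf_pair (hU : G.IsRigidForcedTree U) (hnt : U.Nontrivial) {Δ : ℕ}
    [DecidableRel G.Adj] (hreg : G.IsRegularOfDegree Δ) (hΔ : 2 ≤ Δ) {w : V} {u : U} (hw : w ∉ U)
    (hwu : G.Adj w u) :
    (∃! b, (G.induce U).Adj u b) ∧ ∃ v : U, v ≠ u ∧ (∃! b, (G.induce U).Adj v b) ∧
      ∃ x ∉ U, G.neighborSet x = insert v.1 (G.neighborSet u \ U) := by
  classical
  obtain ⟨v, hvu, hv, hN⟩ := hU.exists_leaf_neighborSet_eq hnt hreg hw u.2 hwu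
  have hpos : (G.neighborSet v \ U).Nonempty := by
    rw [← Set.ncard_pos (Set.toFinite _)]
    have h := degree_induce_add_ncard_diff (G := G) U v
    rw [degree_eq_one_iff_existsUnique_adj.2 hv, hreg.degree_eq] at h
    omega
  obtain ⟨x, hvx, hx⟩ := hpos
  have hwx : w ∈ G.neighborSet x := by
    have : x ∈ G.neighborSet w := hN ▸ .inr ⟨hvx, hx⟩
    exact Adj.symm this
  obtain ⟨v', -, hv', hN'⟩ :=
    hU.exists_leaf_neighborSet_eq hnt hreg hx v.2 (Adj.symm hvx)
  obtain hwv | ⟨hwv', -⟩ := hN' ▸ hwx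
  · exact absurd v.2 (hwv ▸ hw)
  · have : u = v' := Subtype.ext (hU.eq_of_adj hw u.2 v'.2 hwu (Adj.symm hwv'))
    subst this
    exact ⟨hv', v, fun h => hvu (congrArg Subtype.val h), hv, x, hx, hN'⟩

end IsRigidForcedTree

end SimpleGraph

/-- Under the equality hypothesis, a minimum zero forcing set `S` with
connected complement satisfies `|S̄| ≤ 2`. -/
theorem stmt15 {V : Type*} [Fintype V] (G : SimpleGraph V) [DecidableRel G.Adj]
    (n Δ : ℕ) (hn : Fintype.card V = n) (hΔ3 : 3 ≤ Δ)
    (hreg : G.IsRegularOfDegree Δ) (hconn : G.Connected)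
    (hZ : (Δ - 1) * G.zeroForcingNumber = (Δ - 2) * n + 2)
    (S : Set V) (hzf : G.IsZeroForcingSet S)
    (hSc : (G.induce Sᶜ).Connected)
    (hmin : ∀ T : Set V, G.IsZeroForcingSet T → (G.induce Tᶜ).Connected →
      S.ncard ≤ T.ncard) :
    (Sᶜ : Set V).ncard ≤ 2 := by
  classical
  by_contra! hk
  obtain ⟨U, rfl⟩ : ∃ U : Set V, S = Uᶜ := ⟨Sᶜ, by simp⟩
  rw [compl_compl] at hSc hk
  have hsize : ∀ T : Set V, T.ncard + Tᶜ.ncard = n := fun T => by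
    rw [Set.ncard_add_ncard_compl, Nat.card_eq_fintype_card, hn]
  have hmax : ∀ T : Set V, G.IsZeroForcingSet Tᶜ → (G.induce T).Connected →
      T.ncard ≤ U.ncard := by
    intro T hT hTc
    have := hmin Tᶜ hT (by rwa [compl_compl])
    have := hsize T
    have := hsize U
    omega
  have hZle : G.zeroForcingNumber ≤ Uᶜ.ncard := Nat.sInf_le ⟨_, hzf, rfl⟩
  have hcard : Δ * U.ncard + 2 ≤ Uᶜ.ncard + 2 * U.ncard := by
    obtain ⟨d, rfl⟩ := Nat.exists_eq_add_of_le' (show 2 ≤ Δ by omega)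
    have := hsize U
    have h1 : d + 2 - 1 = d + 1 := by omega
    rw [h1, Nat.add_sub_cancel, ← this] at hZ
    nlinarith
  have hrigid : ∀ T : Set V, G.IsZeroForcingSet Tᶜ → (G.induce T).Connected →
      T.ncard = U.ncard → G.IsRigidForcedTree T := by
    intro T hT hTc hTU
    have := hsize T
    have := hsize U
    refine G.isRigidForcedTree_of_maximal hreg hconn hT hTc (hTU ▸ hmax) ?_
    rw [hTU]
    omega
  have hnt : ∀ T : Set V, T.ncard = U.ncard → T.Nontrivial := fun T hT =>
    Set.one_lt_ncard_iff_nontrivial.1 (by omega)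
  have hU := hrigid U hzf hSc rfl
  obtain ⟨w, hw⟩ : (Uᶜ).Nonempty := by
    rw [← Set.ncard_pos (Set.toFinite _)]
    nlinarith
  obtain ⟨u, ⟨hu, hwu⟩, -⟩ := hU.existsUnique_adj w hw
  obtain ⟨hdeg, v, hvu, hv, x, hx, hN⟩ :=
    hU.exists_leaf_pair (hnt U rfl) hreg (by omega) (u := ⟨u, hu⟩) hw hwu
  have hvu' : v.1 ≠ u := fun h => hvu (Subtype.ext h)
  have hwv : w ≠ v := fun h => hw (h ▸ v.2)
  have hxw : G.Adj x w := by
    have : w ∈ G.neighborSet x := hN ▸ .inr ⟨hwu.symm, hw⟩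
    exact this
  have hconn' := hSc.induce_diff_singleton v hv
  have hu' : u ∈ U \ {v.1} := ⟨hu, hvu'.symm⟩
  have hwU' : w ∉ U \ {v.1} := fun h => hw h.1
  have hcardU' : (insert w (U \ {v.1})).ncard = U.ncard := by
    rw [Set.ncard_insert_of_notMem hwU' (Set.toFinite _), Set.ncard_sdiff_singleton_add_one v.2]
  have hU' : G.IsRigidForcedTree (insert w (U \ {v.1})) := by
    refine hrigid _ (hzf.of_forced (w := w) (x := x) ?_ hxw ?_ ?_)
      (hconn'.induce_insert hu' hwu) hcardU'
    · simp [hx, hxw.ne]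
    · intro s hs hsw
      simp_all
    · intro y hy hyw
      obtain rfl | ⟨-, hy⟩ := hN ▸ (show y ∈ G.neighborSet x from hy)
      · simp [hyw]
      · simp [hyw, hy]
  obtain ⟨s, hsu, hsU, hsw⟩ : ∃ s, G.Adj s u ∧ s ∉ U ∧ s ≠ w := by
    have h := G.degree_induce_add_ncard_diff U ⟨u, hu⟩
    rw [SimpleGraph.degree_eq_one_iff_existsUnique_adj.2 hdeg, hreg.degree_eq] at h
    obtain ⟨s, hs, hsw⟩ := Set.exists_ne_of_one_lt_ncard (s := G.neighborSet u \ U)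
      (by simp only at h; omega) w
    exact ⟨s, SimpleGraph.Adj.symm hs.1, hs.2, hsw⟩
  obtain ⟨hdeg', -⟩ := hU'.exists_leaf_pair (hnt _ hcardU') hreg (by omega)
    (u := ⟨u, .inr hu'⟩) (w := s) (by simp [hsU, hsw]) hsu
  have : Nontrivial (U \ {v.1} : Set V) := by
    refine Set.Nontrivial.coe_sort <| Set.one_lt_ncard_iff_nontrivial.1 ?_
    have := Set.ncard_sdiff_singleton_add_one v.2 (Set.toFinite _)
    omega
  obtain ⟨y, huy⟩ := hconn'.preconnected.exists_adj_of_nontrivial ⟨u, hu'⟩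
  have heq := hdeg'.unique (y₁ := ⟨w, .inl rfl⟩) (y₂ := ⟨y, .inr y.2⟩) hwu.symm huy
  have hwy : w = y := congrArg Subtype.val heq
  exact hwU' (hwy ▸ y.2)
end
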